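/- Let g, g' be elements of the restricted symplectic group with diagonal blocks Φ(g), Φ(g') (all invertible). Then Φ(g)Φ(g')Φ(gg')⁻¹ − 1 is trace-class, so the Fredholm determinant C₁(g, g') = det(Φ(g)Φ(g')Φ(gg')⁻¹) is well-defined, and C₁ satisfies the 2-cocycle identity C₁(g, g')·C₁(gg', g'') = C₁(g', g'')·C₁(g, g'g'') with values in ℂ*. -/

import Mathlib

open ContinuousLinearMap Filter

noncomputable section

variable (E : Type) [NormedAddCommGroup E] [InnerProductSpace ℂ E] [CompleteSpace E]
  (b : HilbertBasis ℕ ℂ E)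

def IsHS (A : E →L[ℂ] E) : Prop := Summable fun i => ‖A (b i)‖ ^ 2

def IsTraceClass (A : E →L[ℂ] E) : Prop :=
  ∃ B C : E →L[ℂ] E, IsHS E b B ∧ IsHS E b C ∧ A = B ∘L C

/-- `q` has Fredholm determinant `z` (limit of finite-section determinants). -/
def HasDet (q : E →L[ℂ] E) (z : ℂ) : Prop :=
  Tendsto (fun n : ℕ => Matrix.det fun i j : Fin n =>
    @inner ℂ E _ (b i) (q (b j))) atTop (nhds z)

variable {G : Type} [Group G]

/-- The operator `Φ(g)Φ(g')Φ(gg')⁻¹` underlying the cocycle `C₁`. -/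
def cocOp (Φ : G → (E →L[ℂ] E)ˣ) (g g' : G) : E →L[ℂ] E :=
  (Φ g : E →L[ℂ] E) ∘L (Φ g' : E →L[ℂ] E) ∘L (↑(Φ (g * g'))⁻¹ : E →L[ℂ] E)

open scoped ComplexOrder in
theorem det_bound {n : Type*} [Fintype n] [DecidableEq n] (A : Matrix n n ℂ) :
    ‖(1 + A).det‖ ^ 2 ≤ Real.exp (2 * ‖A.trace‖ + ∑ i, ∑ j, ‖A i j‖ ^ 2) := by
  have hP := Matrix.posSemidef_conjTranspose_mul_self (1 + A)
  have hd := hP.1.det_eq_prod_eigenvalues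
  have ht := hP.1.trace_eq_sum_eigenvalues
  have h1 : ((‖(1 + A).det‖ ^ 2 : ℝ) : ℂ) = ((∏ i, hP.1.eigenvalues i : ℝ) : ℂ) := by
    rw [Matrix.det_mul, Matrix.det_conjTranspose] at hd
    push_cast
    rw [← Complex.conj_mul']
    exact hd
  have h1 := Complex.ofReal_injective h1
  rw [h1]
  calc ∏ i, hP.1.eigenvalues i ≤ ∏ i, Real.exp (hP.1.eigenvalues i - 1) := by
        apply Finset.prod_le_prod
        · intro i _; exact hP.eigenvalues_nonneg i
        · intro i _; have := Real.add_one_le_exp (hP.1.eigenvalues i - 1); linarith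
    _ = Real.exp (∑ i, (hP.1.eigenvalues i - 1)) := (Real.exp_sum _ _).symm
    _ ≤ _ := by
        apply Real.exp_le_exp.2
        have h2 : ((∑ i, hP.1.eigenvalues i : ℝ) : ℂ) = Fintype.card n + A.trace + star A.trace
            + ((∑ i, ∑ j, ‖A i j‖ ^ 2 : ℝ) : ℂ) := by
          push_cast
          refine ht.symm.trans ?_
          rw [Matrix.conjTranspose_add, Matrix.add_mul, Matrix.mul_add]
          simp only [Matrix.conjTranspose_one, one_mul, Matrix.mul_one, Matrix.mul_add, Matrix.trace_add, Matrix.trace_one, Matrix.trace_conjTranspose]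
          have : (A.conjTranspose * A).trace = ∑ i, ∑ j, (‖A i j‖ : ℂ) ^ 2 := by
            rw [Finset.sum_comm]
            simp only [Matrix.trace, Matrix.diag, Matrix.mul_apply, Matrix.conjTranspose_apply]
            refine Finset.sum_congr rfl fun j _ => Finset.sum_congr rfl fun i _ => ?_
            rw [← Complex.conj_mul']; rfl
          rw [this]; ring
        have h3 := congrArg Complex.re h2
        rw [Finset.sum_sub_distrib]
        simp only [Complex.add_re, Complex.ofReal_re, Complex.natCast_re] at h3
        have h4 : (star A.trace).re = A.trace.re := Complex.conj_re _
        have h5 := Complex.re_le_norm A.trace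
        rw [h3, h4]
        simp
        linarith

theorem det_pert (c : ℝ) (ε : ℝ) (hε : 0 < ε) : ∃ δ > 0, ∀ (n : Type) [Fintype n] [DecidableEq n]
    (A D : Matrix n n ℂ), ‖A.trace‖ ≤ c → (∑ i, ∑ j, ‖A i j‖ ^ 2) ≤ c → ‖D.trace‖ ≤ δ →
    (∑ i, ∑ j, ‖D i j‖ ^ 2) ≤ δ → ‖(1 + A + D).det - (1 + A).det‖ ≤ ε := by
  set M := Real.exp (2 * c + 2)
  have hM : 0 < M := Real.exp_pos _
  -- η is the linear scale
  obtain ⟨η, hη0, hη1, hηε⟩ : ∃ η : ℝ, 0 < η ∧ η < 1 ∧ 2 * M * η ≤ ε := by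
    refine ⟨min (1/2) (ε / (2 * M)), by positivity, by
      exact lt_of_le_of_lt (min_le_left _ _) (by norm_num), ?_⟩
    have := min_le_right (1/2) (ε / (2 * M))
    rw [le_div_iff₀ (by positivity)] at this
    linarith
  refine ⟨η ^ 2, by positivity, ?_⟩
  intro n _ _ A D hA1 hA2 hD1 hD2
  let f : ℂ → ℂ := fun z => (1 + A + z • D).det
  have hf : Differentiable ℂ f := by
    simp only [f, Matrix.det_apply]
    simp only [Matrix.add_apply, Matrix.smul_apply, smul_eq_mul]
    fun_prop
  have hb : ∀ z ∈ Metric.ball (0:ℂ) (1/η), ‖f z‖ ≤ M := by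
    intro z hz
    have hz : ‖z‖ * η ≤ 1 := by
      rw [mem_ball_zero_iff, lt_div_iff₀ hη0] at hz; exact hz.le
    have h0 := det_bound (A + z • D)
    rw [← add_assoc] at h0
    have h1 : ‖(A + z • D).trace‖ ≤ c + 1 := by
      rw [Matrix.trace_add, Matrix.trace_smul]
      refine (norm_add_le _ _).trans ?_
      rw [norm_smul]
      have : ‖z‖ * ‖D.trace‖ ≤ ‖z‖ * η ^ 2 := by gcongr
      nlinarith
    have h2 : (∑ i, ∑ j, ‖(A + z • D) i j‖ ^ 2) ≤ 2 * c + 2 := by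
      calc (∑ i, ∑ j, ‖(A + z • D) i j‖ ^ 2) ≤ ∑ i, ∑ j, (2 * ‖A i j‖ ^ 2 + 2 * ‖z‖ ^ 2 * ‖D i j‖ ^ 2) := by
            refine Finset.sum_le_sum fun i _ => Finset.sum_le_sum fun j _ => ?_
            have h := norm_add_le (A i j) (z • D i j)
            rw [norm_smul] at h
            have : ‖(A + z • D) i j‖ = ‖A i j + z • D i j‖ := rfl
            rw [this]
            nlinarith [norm_nonneg (A i j + z • D i j), sq_nonneg (‖A i j‖ - ‖z‖ * ‖D i j‖)]
        _ = 2 * (∑ i, ∑ j, ‖A i j‖ ^ 2) + 2 * ‖z‖ ^ 2 * ∑ i, ∑ j, ‖D i j‖ ^ 2 := by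
            simp only [Finset.sum_add_distrib, Finset.mul_sum]
        _ ≤ 2 * c + 2 * ‖z‖ ^ 2 * η ^ 2 := by gcongr
        _ ≤ _ := by nlinarith [mul_nonneg (norm_nonneg z) hη0.le]
    have h3 : ‖f z‖ ^ 2 ≤ M ^ 2 := by
      refine h0.trans ?_
      rw [← Real.exp_nat_mul]
      apply Real.exp_le_exp.2
      push_cast
      linarith
    exact (sq_le_sq₀ (norm_nonneg _) hM.le).1 h3
  have h0 : (0:ℂ) ∈ Metric.ball (0:ℂ) (1/η) := by simp [hη0]
  have h1 : (1:ℂ) ∈ Metric.ball (0:ℂ) (1/η) := by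
    rw [mem_ball_zero_iff, norm_one, lt_div_iff₀ hη0]; linarith
  have hs := Complex.dist_le_div_mul_dist_of_mapsTo_ball (f := f) (c := 0) (z := 1) (R₁ := 1/η) (R₂ := 2 * M)
    hf.differentiableOn (by
      intro z hz
      rw [Metric.mem_closedBall, dist_eq_norm]
      refine (norm_sub_le _ _).trans ?_
      linarith [hb z hz, hb 0 h0]) h1
  simp only [f, one_smul, zero_smul, add_zero, dist_eq_norm, sub_zero, norm_one, mul_one] at hs
  refine hs.trans ?_
  rw [div_div_eq_mul_div, div_one]
  exact hηε

theorem cs_tsum (f g : ℕ → ℂ) (z : ℂ) (hfg : HasSum (fun k => f k * g k) z)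
    (hf : Summable fun k => ‖f k‖ ^ 2) (hg : Summable fun k => ‖g k‖ ^ 2) :
    ‖z‖ ^ 2 ≤ (∑' k, ‖f k‖ ^ 2) * ∑' k, ‖g k‖ ^ 2 := by
  refine le_of_tendsto (Tendsto.pow (Tendsto.norm hfg) 2) (Eventually.of_forall fun s => ?_)
  calc ‖∑ k ∈ s, f k * g k‖ ^ 2 ≤ (∑ k ∈ s, ‖f k‖ * ‖g k‖) ^ 2 := by
        gcongr
        refine (norm_sum_le _ _).trans (le_of_eq ?_)
        simp
    _ ≤ (∑ k ∈ s, ‖f k‖ ^ 2) * ∑ k ∈ s, ‖g k‖ ^ 2 := Finset.sum_mul_sq_le_sq_mul_sq _ _ _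
    _ ≤ _ := by
        exact mul_le_mul (hf.sum_le_tsum _ (fun _ _ => by positivity))
          (hg.sum_le_tsum _ (fun _ _ => by positivity)) (by positivity)
          (tsum_nonneg fun _ => by positivity)

variable {E}

theorem parseval (x : E) : HasSum (fun i => ‖@inner ℂ E _ (b i) x‖ ^ 2) (‖x‖ ^ 2) := by
  have h := b.hasSum_inner_mul_inner x x
  have h2 := Complex.hasSum_re h
  have e : (fun i => ‖@inner ℂ E _ (b i) x‖ ^ 2) = fun i =>
      (@inner ℂ E _ x (b i) * @inner ℂ E _ (b i) x).re := by
    funext i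
    rw [← inner_conj_symm x (b i), Complex.conj_mul']
    norm_cast
  rw [e]
  convert h2 using 1
  rw [inner_self_eq_norm_sq_to_K]
  norm_cast

theorem IsHS.adj {A : E →L[ℂ] E} (hA : IsHS E b A) : IsHS E b (adjoint A) := by
  have h1 : Summable (fun p : ℕ × ℕ => ‖@inner ℂ E _ (b p.2) (A (b p.1))‖ ^ 2) := by
    refine (summable_prod_of_nonneg (fun _ => by positivity)).2 ⟨fun j => (parseval b (A (b j))).summable, ?_⟩
    simp only [(parseval b (A (b _))).tsum_eq]
    exact hA
  have h2 := h1.prod_symm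
  have h3 := ((summable_prod_of_nonneg (fun _ => by positivity)).1 h2).2
  refine h3.congr fun i => ?_
  rw [← (parseval b (adjoint A (b i))).tsum_eq]
  refine tsum_congr fun j => ?_
  simp only [Prod.swap]
  rw [adjoint_inner_right, norm_inner_symm]

theorem IsHS.left {A : E →L[ℂ] E} (hA : IsHS E b A) (S : E →L[ℂ] E) : IsHS E b (S ∘L A) := by
  refine Summable.of_nonneg_of_le (fun _ => by positivity) (fun i => ?_) (Summable.mul_left (‖S‖ ^ 2) hA)
  rw [← mul_pow]
  gcongr
  exact S.le_opNorm _

theorem IsHS.right {A : E →L[ℂ] E} (hA : IsHS E b A) (S : E →L[ℂ] E) : IsHS E b (A ∘L S) := by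
  have := ((hA.adj b).left b (adjoint S)).adj b
  rwa [← adjoint_comp, adjoint_adjoint] at this

theorem IsHS.neg {A : E →L[ℂ] E} (hA : IsHS E b A) : IsHS E b (-A) := by
  simpa [IsHS] using hA

theorem IsHS.add {A B : E →L[ℂ] E} (hA : IsHS E b A) (hB : IsHS E b B) : IsHS E b (A + B) := by
  refine Summable.of_nonneg_of_le (fun _ => by positivity) (fun i => ?_)
    ((Summable.mul_left 2 hA).add (Summable.mul_left 2 hB))
  have h := norm_add_le (A (b i)) (B (b i))
  change ‖A (b i) + B (b i)‖ ^ 2 ≤ _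
  nlinarith [norm_nonneg (A (b i) + B (b i)), sq_nonneg (‖A (b i)‖ - ‖B (b i)‖)]

/-- Hilbert-Schmidt with summable diagonal. -/
def TT (K : E →L[ℂ] E) : Prop :=
  IsHS E b K ∧ Summable fun j => @inner ℂ E _ (b j) (K (b j))

theorem TT.add {K L : E →L[ℂ] E} (hK : TT b K) (hL : TT b L) : TT b (K + L) := by
  refine ⟨hK.1.add b hL.1, (hK.2.add hL.2).congr fun j => ?_⟩
  simp [inner_add_right]

theorem TT.comp {K L : E →L[ℂ] E} (hK : IsHS E b K) (hL : IsHS E b L) : TT b (K ∘L L) := by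
  refine ⟨hL.left b K, ?_⟩
  refine Summable.of_norm_bounded (Summable.add (hK.adj b) hL) fun j => ?_
  have : @inner ℂ E _ (b j) ((K ∘L L) (b j)) = @inner ℂ E _ (adjoint K (b j)) (L (b j)) := by
    rw [adjoint_inner_left]; rfl
  rw [this]
  have h := norm_inner_le_norm (𝕜 := ℂ) (adjoint K (b j)) (L (b j))
  nlinarith [sq_nonneg (‖adjoint K (b j)‖ - ‖L (b j)‖), norm_nonneg (adjoint K (b j)), norm_nonneg (L (b j))]

/-- Finite section. -/
def sec (K : E →L[ℂ] E) (n : ℕ) : Matrix (Fin n) (Fin n) ℂ :=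
  Matrix.of fun i j => @inner ℂ E _ (b i) (K (b j))

/-- squared HS norm of the finite section -/
def hsq (K : E →L[ℂ] E) (n : ℕ) : ℝ := ∑ i, ∑ j, ‖sec b K n i j‖ ^ 2

theorem hsq_le {K : E →L[ℂ] E} (hK : IsHS E b K) (n : ℕ) : hsq b K n ≤ ∑' j, ‖K (b j)‖ ^ 2 := by
  unfold hsq
  rw [Finset.sum_comm]
  calc _ ≤ ∑ j : Fin n, ‖K (b j)‖ ^ 2 := by
        refine Finset.sum_le_sum fun j _ => ?_
        simp only [sec, Matrix.of_apply]
        rw [Fin.sum_univ_eq_sum_range (fun i => ‖@inner ℂ E _ (b i) (K (b j))‖ ^ 2)]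
        exact b.orthonormal.sum_inner_products_le _
    _ = ∑ j ∈ Finset.range n, ‖K (b j)‖ ^ 2 := Fin.sum_univ_eq_sum_range (fun j => ‖K (b j)‖ ^ 2) n
    _ ≤ _ := Summable.sum_le_tsum _ (fun _ _ => by positivity) hK

theorem trace_sec (K : E →L[ℂ] E) (n : ℕ) : (sec b K n).trace =
    ∑ j ∈ Finset.range n, @inner ℂ E _ (b j) (K (b j)) :=
  Fin.sum_univ_eq_sum_range (fun j => @inner ℂ E _ (b j) (K (b j))) n

theorem sec_comp_err {X Y : E →L[ℂ] E} (hX : IsHS E b X) (hY : IsHS E b Y) :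
    Tendsto (fun n => (sec b (X ∘L Y) n - sec b X n * sec b Y n).trace) atTop (nhds 0) ∧
    Tendsto (fun n => ∑ i, ∑ j, ‖(sec b (X ∘L Y) n - sec b X n * sec b Y n) i j‖ ^ 2) atTop (nhds 0) := by
  set α : ℕ → ℝ := fun n => ∑' k, ‖X (b (k + n))‖ ^ 2
  set β : ℕ → ℝ := fun n => ∑' k, ‖adjoint Y (b (k + n))‖ ^ 2
  have hα : Tendsto α atTop (nhds 0) := tendsto_sum_nat_add (fun k => ‖X (b k)‖ ^ 2)
  have hβ : Tendsto β atTop (nhds 0) := tendsto_sum_nat_add (fun k => ‖adjoint Y (b k)‖ ^ 2)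
  have hαβ : Tendsto (fun n => α n * β n) atTop (nhds 0) := by simpa using hα.mul hβ
  have hα0 : ∀ n, 0 ≤ α n := fun n => tsum_nonneg fun _ => by positivity
  have hβ0 : ∀ n, 0 ≤ β n := fun n => tsum_nonneg fun _ => by positivity
  let x : ℕ → ℕ → ℝ := fun n i => ∑' k, ‖@inner ℂ E _ (b i) (X (b (k + n)))‖ ^ 2
  let y : ℕ → ℕ → ℝ := fun n j => ∑' k, ‖@inner ℂ E _ (b (k + n)) (Y (b j))‖ ^ 2
  have hxs : ∀ n i, Summable fun k => ‖@inner ℂ E _ (b i) (X (b (k + n)))‖ ^ 2 := fun n i => by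
    have := (summable_nat_add_iff n).2 (parseval b (adjoint X (b i))).summable
    refine this.congr fun k => ?_
    rw [adjoint_inner_right, norm_inner_symm]
  have hys : ∀ n j, Summable fun k => ‖@inner ℂ E _ (b (k + n)) (Y (b j))‖ ^ 2 := fun n j =>
    (summable_nat_add_iff n).2 (parseval b (Y (b j))).summable
  have hx0 : ∀ n i, 0 ≤ x n i := fun n i => tsum_nonneg fun _ => by positivity
  have hy0 : ∀ n i, 0 ≤ y n i := fun n i => tsum_nonneg fun _ => by positivity
  have hx : ∀ n, ∑ i : Fin n, x n i ≤ α n := fun n => by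
    rw [Fin.sum_univ_eq_sum_range (x n), ← Summable.tsum_finsetSum (fun i _ => hxs n i)]
    refine Summable.tsum_le_tsum (fun k => b.orthonormal.sum_inner_products_le _)
      (summable_sum fun i _ => hxs n i) ((summable_nat_add_iff (f := fun k => ‖X (b k)‖ ^ 2) n).2 hX)
  have hy : ∀ n, ∑ i : Fin n, y n i ≤ β n := fun n => by
    rw [Fin.sum_univ_eq_sum_range (y n), ← Summable.tsum_finsetSum (fun i _ => hys n i)]
    refine Summable.tsum_le_tsum (fun k => ?_)
      (summable_sum fun i _ => hys n i) ((summable_nat_add_iff (f := fun k => ‖adjoint Y (b k)‖ ^ 2) n).2 (hY.adj b))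
    refine le_trans (le_of_eq ?_) (b.orthonormal.sum_inner_products_le (s := Finset.range n) _)
    refine Finset.sum_congr rfl fun j _ => ?_
    rw [adjoint_inner_right, norm_inner_symm]
  have hE : ∀ n (i j : Fin n), ‖(sec b (X ∘L Y) n - sec b X n * sec b Y n) i j‖ ^ 2 ≤ x n i * y n j := by
    intro n i j
    refine cs_tsum _ _ _ ?_ (hxs n i) (hys n j)
    have h := b.hasSum_inner_mul_inner (adjoint X (b i)) (Y (b j))
    simp only [adjoint_inner_left] at h
    have h2 := (hasSum_nat_add_iff' n).2 h
    have h3 : (sec b (X ∘L Y) n - sec b X n * sec b Y n) i j = @inner ℂ E _ (b i) (X (Y (b j))) -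
        ∑ k ∈ Finset.range n, @inner ℂ E _ (b i) (X (b k)) * @inner ℂ E _ (b k) (Y (b j)) := by
      rw [Matrix.sub_apply, Matrix.mul_apply]
      simp only [sec, Matrix.of_apply]
      rw [Fin.sum_univ_eq_sum_range
        (fun k => @inner ℂ E _ (b i) (X (b k)) * @inner ℂ E _ (b k) (Y (b j)))]
      rfl
    rw [h3]
    exact h2
  constructor
  · have h2 : Tendsto (fun n => ‖(sec b (X ∘L Y) n - sec b X n * sec b Y n).trace‖ ^ 2) atTop (nhds 0) := by
      refine squeeze_zero (fun _ => by positivity) (fun n => ?_) hαβ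
      calc _ ≤ (∑ i, ‖(sec b (X ∘L Y) n - sec b X n * sec b Y n) i i‖) ^ 2 := by
            gcongr
            exact norm_sum_le _ _
        _ ≤ (∑ i : Fin n, x n i) * ∑ i : Fin n, y n i :=
            Finset.sum_sq_le_sum_mul_sum_of_sq_le_mul _ (fun i _ => hx0 n i) (fun i _ => hy0 n i)
              (fun i _ => hE n i i)
        _ ≤ _ := mul_le_mul (hx n) (hy n) (Finset.sum_nonneg fun i _ => hy0 n i) (hα0 n)
    rw [tendsto_zero_iff_norm_tendsto_zero]
    have := h2.sqrt
    simpa [Real.sqrt_sq] using this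
  · refine squeeze_zero (fun _ => by positivity) (fun n => ?_) hαβ
    calc _ ≤ ∑ i : Fin n, ∑ j : Fin n, x n i * y n j :=
          Finset.sum_le_sum fun i _ => Finset.sum_le_sum fun j _ => hE n i j
      _ = (∑ i : Fin n, x n i) * ∑ i : Fin n, y n i := (Finset.sum_mul_sum _ _ _ _).symm
      _ ≤ _ := mul_le_mul (hx n) (hy n) (Finset.sum_nonneg fun i _ => hy0 n i) (hα0 n)

theorem TT.bdd {K : E →L[ℂ] E} (hK : TT b K) : ∃ c : ℝ, ∀ n, ‖(sec b K n).trace‖ ≤ c ∧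
    (∑ i, ∑ j, ‖sec b K n i j‖ ^ 2) ≤ c := by
  have h1 := hK.2.hasSum.tendsto_sum_nat
  obtain ⟨c, hc⟩ := h1.norm.bddAbove_range
  refine ⟨max c (∑' j, ‖K (b j)‖ ^ 2), fun n => ⟨?_, ?_⟩⟩
  · rw [trace_sec]
    exact le_max_of_le_left (hc ⟨n, rfl⟩)
  · exact le_max_of_le_right (hsq_le b hK.1 n)

theorem TT.pert {K X Y : E →L[ℂ] E} (hK : TT b K) (hX : IsHS E b X) (hY : IsHS E b Y) :
    Tendsto (fun n => (1 + sec b K n + -(sec b (X ∘L Y) n - sec b X n * sec b Y n)).det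
      - (1 + sec b K n).det) atTop (nhds 0) := by
  obtain ⟨c, hc⟩ := hK.bdd
  obtain ⟨h1, h2⟩ := sec_comp_err b hX hY
  rw [Metric.tendsto_atTop]
  intro ε hε
  obtain ⟨δ, hδ, H⟩ := det_pert c (ε / 2) (by positivity)
  obtain ⟨N1, hN1⟩ := Metric.tendsto_atTop.1 h1 δ hδ
  obtain ⟨N2, hN2⟩ := Metric.tendsto_atTop.1 h2 δ hδ
  refine ⟨max N1 N2, fun n hn => ?_⟩
  have a1 := hN1 n (le_of_max_le_left hn)
  have a2 := hN2 n (le_of_max_le_right hn)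
  rw [dist_zero_right] at a1 a2 ⊢
  refine lt_of_le_of_lt (H (Fin n) _ _ (hc n).1 (hc n).2 ?_ ?_) (half_lt_self hε)
  · rw [Matrix.trace_neg, norm_neg]; exact a1.le
  · simp only [Matrix.neg_apply, norm_neg]
    exact (Real.le_norm_self _).trans a2.le

theorem TT.det_mul {K L : E →L[ℂ] E} (hK : TT b K) (hL : TT b L) :
    Tendsto (fun n => (1 + sec b K n).det * (1 + sec b L n).det
      - (1 + sec b (K + L + K ∘L L) n).det) atTop (nhds 0) := by
  refine (((hK.add b hL).add b (TT.comp b hK.1 hL.1)).pert b hK.1 hL.1).congr fun n => ?_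
  rw [← Matrix.det_mul]
  congr 2
  have : sec b (K + L + K ∘L L) n = sec b K n + sec b L n + sec b (K ∘L L) n := by
    ext i j; simp [sec, inner_add_right]
  rw [this]
  noncomm_ring

theorem det_comm {X Y : E →L[ℂ] E} (hX : IsHS E b X) (hY : IsHS E b Y) :
    Tendsto (fun n => (1 + sec b (X ∘L Y) n).det - (1 + sec b (Y ∘L X) n).det) atTop (nhds 0) := by
  have h := ((TT.comp b hY hX).pert b hY hX).sub ((TT.comp b hX hY).pert b hX hY)
  rw [sub_zero] at h
  refine h.congr fun n => ?_
  have e1 : 1 + sec b (X ∘L Y) n + -(sec b (X ∘L Y) n - sec b X n * sec b Y n) =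
    1 + sec b X n * sec b Y n := by abel
  have e2 : 1 + sec b (Y ∘L X) n + -(sec b (Y ∘L X) n - sec b Y n * sec b X n) =
    1 + sec b Y n * sec b X n := by abel
  rw [e1, e2, Matrix.det_one_add_mul_comm]
  ring

theorem TT.exists_det {K : E →L[ℂ] E} (hK : TT b K) :
    ∃ z, Tendsto (fun n => (1 + sec b K n).det) atTop (nhds z) := by
  obtain ⟨c, hc⟩ := hK.bdd
  apply cauchySeq_tendsto_of_complete
  have ht : CauchySeq fun n => (sec b K n).trace := by
    simp only [trace_sec]
    exact hK.2.hasSum.tendsto_sum_nat.cauchySeq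
  let f : ℕ → ℕ → ℝ := fun i j => ‖@inner ℂ E _ (b i) (K (b j))‖ ^ 2
  have hf : ∀ n, hsq b K n = ∑ i ∈ Finset.range n, ∑ j ∈ Finset.range n, f i j := fun n => by
    rw [← Fin.sum_univ_eq_sum_range (fun i => ∑ j ∈ Finset.range n, f i j)]
    refine Finset.sum_congr rfl fun i _ => ?_
    exact Fin.sum_univ_eq_sum_range (f i) n
  have hh : CauchySeq (hsq b K) := by
    have hm : Monotone (hsq b K) := by
      intro n m hnm
      rw [hf, hf, ← Finset.sum_product', ← Finset.sum_product']
      refine Finset.sum_le_sum_of_subset_of_nonneg ?_ (fun _ _ _ => by positivity)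
      exact Finset.product_subset_product (Finset.range_mono hnm) (Finset.range_mono hnm)
    have hB : BddAbove (Set.range (hsq b K)) := ⟨∑' j, ‖K (b j)‖ ^ 2, by
      rintro _ ⟨n, rfl⟩; exact hsq_le b hK.1 n⟩
    exact (tendsto_atTop_ciSup hm hB).cauchySeq
  rw [Metric.cauchySeq_iff']
  intro ε hε
  obtain ⟨δ, hδ, H⟩ := det_pert c (ε / 2) (by positivity)
  obtain ⟨N1, hN1⟩ := Metric.cauchySeq_iff.1 ht δ hδ
  obtain ⟨N2, hN2⟩ := Metric.cauchySeq_iff.1 hh δ hδ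
  refine ⟨max N1 N2, fun m hm => ?_⟩
  set n := max N1 N2 with hn
  obtain ⟨k, rfl⟩ := Nat.exists_eq_add_of_le hm
  have a1 := hN1 (n + k) ((le_max_left _ _).trans hm) n (le_max_left _ _)
  have a2 := hN2 (n + k) ((le_max_right _ _).trans hm) n (le_max_right _ _)
  clear_value n
  let e := (finSumFinEquiv : Fin n ⊕ Fin k ≃ Fin (n + k))
  let S : Matrix (Fin n ⊕ Fin k) (Fin n ⊕ Fin k) ℂ := (sec b K (n + k)).submatrix e e
  let A : Matrix (Fin n ⊕ Fin k) (Fin n ⊕ Fin k) ℂ := Matrix.fromBlocks (sec b K n) 0 0 0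
  have hdA : (1 + A).det = (1 + sec b K n).det := by
    have : 1 + A = Matrix.fromBlocks (1 + sec b K n) 0 0 1 := by
      rw [← Matrix.fromBlocks_one, Matrix.fromBlocks_add]; simp
    rw [this, Matrix.det_fromBlocks_zero₂₁]; simp
  have hdS : (1 + S).det = (1 + sec b K (n + k)).det := by
    rw [← Matrix.det_submatrix_equiv_self e (1 + sec b K (n + k))]
    congr 1
    ext i j
    simp [S, Matrix.one_apply]
  have htA : A.trace = (sec b K n).trace := by simp [A, Matrix.trace, Fintype.sum_sum_type]
  have htS : S.trace = (sec b K (n + k)).trace := by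
    exact Equiv.sum_comp e (fun i => sec b K (n + k) i i)
  have hhA : (∑ i, ∑ j, ‖A i j‖ ^ 2) = hsq b K n := by
    simp [A, Fintype.sum_sum_type, hsq]
  have hhS : (∑ i, ∑ j, ‖S i j‖ ^ 2) = hsq b K (n + k) := by
    have h1 : ∀ i, ∑ j, ‖S i j‖ ^ 2 = ∑ j, ‖sec b K (n + k) (e i) j‖ ^ 2 := fun i =>
      Equiv.sum_comp e (fun j => ‖sec b K (n + k) (e i) j‖ ^ 2)
    simp only [h1]
    exact Equiv.sum_comp e (fun i => ∑ j, ‖sec b K (n + k) i j‖ ^ 2)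
  have hblock : ∀ i j, S (Sum.inl i) (Sum.inl j) = sec b K n i j := by
    intro i j; simp [S, e, sec]
  have hhD : (∑ i, ∑ j, ‖(S - A) i j‖ ^ 2) = hsq b K (n + k) - hsq b K n := by
    rw [← hhA, ← hhS, ← Finset.sum_sub_distrib]
    refine Finset.sum_congr rfl fun i _ => ?_
    rw [← Finset.sum_sub_distrib]
    refine Finset.sum_congr rfl fun j _ => ?_
    rw [Matrix.sub_apply]
    rcases i with i | i <;> rcases j with j | j <;> simp [A, hblock]
  have := H (Fin n ⊕ Fin k) A (S - A) (by rw [htA]; exact (hc n).1) (by rw [hhA]; exact (hc n).2)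
    (by rw [Matrix.trace_sub, htA, htS, ← dist_eq_norm]; exact a1.le)
    (by rw [hhD]; exact (le_abs_self _).trans a2.le)
  rw [show 1 + A + (S - A) = 1 + S by abel, hdA, hdS] at this
  rw [dist_eq_norm]
  linarith

variable (E)

theorem hasDet_iff (q : E →L[ℂ] E) (z : ℂ) : HasDet E b q z ↔
    Tendsto (fun n => (1 + sec b (q - 1) n).det) atTop (nhds z) := by
  unfold HasDet
  have : ∀ n : ℕ, Matrix.det (fun i j : Fin n => @inner ℂ E _ (b i) (q (b j))) =
      (1 + sec b (q - 1) n).det := by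
    intro n
    congr 1
    funext i j
    have h := orthonormal_iff_ite.1 b.orthonormal i j
    simp [sec, inner_sub_right, h, Matrix.one_apply, Fin.ext_iff]
  simp only [this]

/-- For elements of the restricted symplectic group with diagonal blocks `Φ(g)` and
Hilbert–Schmidt off-diagonal blocks (so that `Φ(gg') = Φ(g)Φ(g') + Ψ(g)Ψ̄(g')`),
`Φ(g)Φ(g')Φ(gg')⁻¹ - 1` is trace-class, so `C₁(g,g') = det(Φ(g)Φ(g')Φ(gg')⁻¹)` is a
well-defined Fredholm determinant, and `C₁` satisfies the `2`-cocycle identity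
`C₁(g,g')·C₁(gg',g'') = C₁(g',g'')·C₁(g,g'g'')` in `ℂ*`. -/
theorem stmt13 (Φ : G → (E →L[ℂ] E)ˣ) (Ψ Ψb : G → (E →L[ℂ] E))
    (hΨ : ∀ g, IsHS E b (Ψ g)) (hΨb : ∀ g, IsHS E b (Ψb g))
    (hmul : ∀ g g' : G, (↑(Φ (g * g')) : E →L[ℂ] E) =
      (Φ g : E →L[ℂ] E) ∘L (Φ g' : E →L[ℂ] E) + (Ψ g) ∘L (Ψb g')) :
    (∀ g g' : G, IsTraceClass E b (cocOp E Φ g g' - 1)) ∧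
    (∀ g g' : G, ∃ z : ℂ, z ≠ 0 ∧ HasDet E b (cocOp E Φ g g') z) ∧
    (∀ g g' g'' : G, ∀ z₁ z₂ z₃ z₄ : ℂ,
      HasDet E b (cocOp E Φ g g') z₁ →
      HasDet E b (cocOp E Φ (g * g') g'') z₂ →
      HasDet E b (cocOp E Φ g' g'') z₃ →
      HasDet E b (cocOp E Φ g (g' * g'')) z₄ →
      z₁ * z₂ = z₃ * z₄) := by
  have hco : ∀ g g', cocOp E Φ g g' - 1 = (-(Ψ g)) ∘L (Ψb g' ∘L (↑(Φ (g * g'))⁻¹ : E →L[ℂ] E)) := by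
    intro g g'
    have h1 : (↑(Φ g) * ↑(Φ g') : E →L[ℂ] E) = ↑(Φ (g * g')) - Ψ g * Ψb g' :=
      eq_sub_of_add_eq (hmul g g').symm
    change (↑(Φ g) * (↑(Φ g') * ↑(Φ (g * g'))⁻¹) : E →L[ℂ] E) - 1 = -Ψ g * (Ψb g' * ↑(Φ (g * g'))⁻¹)
    rw [← mul_assoc, h1, sub_mul, Units.mul_inv]
    noncomm_ring
  have hT : ∀ g g', TT b (cocOp E Φ g g' - 1) := fun g g' => by
    rw [hco]; exact TT.comp b ((hΨ g).neg b) ((hΨb g').right b _)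
  refine ⟨fun g g' => ⟨_, _, (hΨ g).neg b, (hΨb g').right b _, hco g g'⟩, fun g g' => ?_, ?_⟩
  · obtain ⟨z, hz⟩ := (hT g g').exists_det
    refine ⟨z, ?_, (hasDet_iff E b _ _).2 hz⟩
    let u := Φ g * Φ g' * (Φ (g * g'))⁻¹
    have hu : cocOp E Φ g g' = (u : E →L[ℂ] E) := by
      simp only [u, Units.val_mul, mul_assoc]; rfl
    have hL : TT b ((↑u⁻¹ : E →L[ℂ] E) - 1) := by
      have : (↑u⁻¹ : E →L[ℂ] E) - 1 = Ψ g ∘L (Ψb g' ∘L ((Φ (g * g'))⁻¹ * u⁻¹ : (E →L[ℂ] E)ˣ)) := by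
        have h2 := hco g g'
        rw [hu] at h2
        have h3 : (↑u⁻¹ : E →L[ℂ] E) - 1 = -(((u : E →L[ℂ] E) - 1) * ↑u⁻¹) := by
          rw [sub_mul, Units.mul_inv]; noncomm_ring
        rw [h3, h2]
        change -((-Ψ g * (Ψb g' * _)) * _) = Ψ g * (Ψb g' * _)
        rw [Units.val_mul]
        noncomm_ring
      rw [this]
      exact TT.comp b (hΨ g) ((hΨb g').right b _)
    obtain ⟨w, hw⟩ := hL.exists_det
    have h := (hT g g').det_mul b hL
    have e : (cocOp E Φ g g' - 1) + ((↑u⁻¹ : E →L[ℂ] E) - 1) +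
        (cocOp E Φ g g' - 1) ∘L ((↑u⁻¹ : E →L[ℂ] E) - 1) = 0 := by
      rw [hu]
      change ((u : E →L[ℂ] E) - 1) + ((↑u⁻¹ : E →L[ℂ] E) - 1) +
        ((u : E →L[ℂ] E) - 1) * ((↑u⁻¹ : E →L[ℂ] E) - 1) = 0
      rw [sub_mul, mul_sub, Units.mul_inv]
      noncomm_ring
    rw [e] at h
    have h0 : ∀ n, sec b (0 : E →L[ℂ] E) n = 0 := fun n => by ext i j; simp [sec]
    simp only [h0, add_zero, Matrix.det_one] at h
    have h' := tendsto_nhds_unique h ((hz.mul hw).sub_const 1)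
    rintro rfl
    simp at h'
  · intro g g' g'' z₁ z₂ z₃ z₄ h₁ h₂ h₃ h₄
    rw [hasDet_iff] at h₁ h₂ h₃ h₄
    let S : E →L[ℂ] E := Φ g
    let S' : E →L[ℂ] E := ↑(Φ g)⁻¹
    let B : E →L[ℂ] E := -(Ψ g')
    let C : E →L[ℂ] E := Ψb g'' ∘L (↑(Φ (g' * g''))⁻¹ : E →L[ℂ] E)
    have hB : IsHS E b B := (hΨ g').neg b
    have hC : IsHS E b C := (hΨb g'').right b _
    have hSS : S' * S = 1 := Units.inv_mul _
    -- conjugated operator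
    have hK : TT b ((S ∘L B) ∘L (C ∘L S')) := TT.comp b (hB.left b S) (hC.right b S')
    have hconj : Tendsto (fun n => (1 + sec b ((S ∘L B) ∘L (C ∘L S')) n).det) atTop (nhds z₃) := by
      have c1 := det_comm b (hB.left b S) (hC.right b S')
      have c2 := det_comm b hC hB
      have e : (C ∘L S') ∘L (S ∘L B) = C ∘L B := by
        change (C * S') * (S * B) = C * B
        rw [mul_assoc, ← mul_assoc S', hSS, one_mul]
      rw [e] at c1
      rw [hco] at h₃
      have := (c1.add c2).add h₃
      rw [add_zero, zero_add] at this
      refine this.congr fun n => ?_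
      ring
    have m1 := (hT g g').det_mul b (hT (g * g') g'')
    have m2 := hK.det_mul b (hT g (g' * g''))
    have r1 : ∀ q q' : E →L[ℂ] E, (q - 1) + (q' - 1) + (q - 1) ∘L (q' - 1) = q * q' - 1 := by
      intro q q'
      change (q - 1) + (q' - 1) + (q - 1) * (q' - 1) = q * q' - 1
      noncomm_ring
    have r2 : (S ∘L B) ∘L (C ∘L S') = S * cocOp E Φ g' g'' * S' - 1 := by
      have h5 : S * S' = 1 := Units.mul_inv _
      have h6 : (S ∘L B) ∘L (C ∘L S') = S * (cocOp E Φ g' g'' - 1) * S' := by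
        rw [hco]
        change (S * B) * (C * S') = S * (B * C) * S'
        noncomm_ring
      rw [h6, mul_sub, sub_mul, mul_one, h5]
    have r3 : cocOp E Φ g g' * cocOp E Φ (g * g') g'' =
        S * cocOp E Φ g' g'' * S' * cocOp E Φ g (g' * g'') := by
      have hc : ∀ g g', cocOp E Φ g g' = ((Φ g * Φ g' * (Φ (g * g'))⁻¹ : (E →L[ℂ] E)ˣ) : E →L[ℂ] E) := by
        intro g g'
        simp only [Units.val_mul, mul_assoc]; rfl
      simp only [hc, S, S', ← Units.val_mul]
      congr 1
      rw [mul_assoc g g' g'']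
      group
    rw [r1] at m1
    rw [r2] at m2 hconj
    rw [r1, ← r3] at m2
    have f1 := tendsto_nhds_unique (m1.sub m2) (((h₁.mul h₂).sub (hconj.mul h₄)).congr fun n => by ring)
    rw [sub_zero] at f1
    exact sub_eq_zero.1 f1.symm

end
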